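/- Define η(x,t) = −1 and u(x,t) = 1 + 6·sech²((1/√2)·(x − 20 − 3t)). Then η and u are smooth on ℝ² and satisfy, at every point (x,t) ∈ ℝ², the abcd Boussinesq system with parameters a = 0, b = d = 1/3, c = −1/3, that is, ∂ₜη + ∂ₓu + ∂ₓ(ηu) − (1/3)·∂ₓ²∂ₜη = 0 and ∂ₜu + ∂ₓη + ∂ₓ(u²/2) − (1/3)·∂ₓ³η − (1/3)·∂ₓ²∂ₜu = 0. -/

import Mathlib

/-- The squared hyperbolic secant with wave number `1 / √2`. -/
noncomputable def sechSq (z : ℝ) : ℝ := (1 / Real.cosh (1 / Real.sqrt 2 * z)) ^ 2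

/-- The derivative of `sechSq`. -/
noncomputable def sechSqDeriv (z : ℝ) : ℝ :=
  -2 * (1 / Real.sqrt 2) * Real.sinh (1 / Real.sqrt 2 * z) / Real.cosh (1 / Real.sqrt 2 * z) ^ 3

lemma contDiff_sechSq {n : WithTop ℕ∞} : ContDiff ℝ n sechSq := by
  unfold sechSq
  exact (contDiff_const.div (Real.contDiff_cosh.comp (contDiff_const.mul contDiff_id))
    fun z => (Real.cosh_pos _).ne').pow 2

lemma hasDerivAt_sechSq (z : ℝ) : HasDerivAt sechSq (sechSqDeriv z) z := by
  have hc := (Real.cosh_pos (1 / Real.sqrt 2 * z)).ne'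
  have hl : HasDerivAt (fun z : ℝ => 1 / Real.sqrt 2 * z) (1 / Real.sqrt 2) z := by
    simpa using (hasDerivAt_id z).const_mul (1 / Real.sqrt 2)
  refine (((hasDerivAt_const z (1 : ℝ)).fun_div hl.cosh hc).fun_pow 2).congr_deriv ?_
  unfold sechSqDeriv
  generalize Real.sinh (1 / Real.sqrt 2 * z) = S at *
  generalize Real.cosh (1 / Real.sqrt 2 * z) = C at *
  generalize 1 / Real.sqrt 2 = k at *
  norm_num
  field_simp

lemma hasDerivAt_sechSqDeriv (z : ℝ) :
    HasDerivAt sechSqDeriv (2 * sechSq z - 3 * sechSq z ^ 2) z := by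
  have hc := (Real.cosh_pos (1 / Real.sqrt 2 * z)).ne'
  have hl : HasDerivAt (fun z : ℝ => 1 / Real.sqrt 2 * z) (1 / Real.sqrt 2) z := by
    simpa using (hasDerivAt_id z).const_mul (1 / Real.sqrt 2)
  have hk : (1 / Real.sqrt 2) ^ 2 = (1 / 2 : ℝ) := by
    rw [div_pow, Real.sq_sqrt (by norm_num)]; norm_num
  refine ((hl.sinh.const_mul (-2 * (1 / Real.sqrt 2))).fun_div (hl.cosh.fun_pow 3)
    (pow_ne_zero 3 hc)).congr_deriv ?_
  unfold sechSq
  have hs := Real.sinh_sq (1 / Real.sqrt 2 * z)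
  generalize Real.sinh (1 / Real.sqrt 2 * z) = S at *
  generalize Real.cosh (1 / Real.sqrt 2 * z) = C at *
  generalize 1 / Real.sqrt 2 = k at *
  field_simp
  norm_num
  linear_combination 6 * k ^ 2 * C ^ 2 * hs + (4 * C ^ 4 - 6 * C ^ 2) * hk

/-- η ≡ -1, u a traveling sech² profile, solve the abcd system with
a = 0, b = d = 1/3, c = -1/3. -/
theorem abcd_boussinesq_case6
    (η u : ℝ → ℝ → ℝ)
    (hη : ∀ x t : ℝ, η x t = -1)
    (hu : ∀ x t : ℝ, u x t =
      1 + 6 * (1 / Real.cosh (1 / Real.sqrt 2 * (x - 20 - 3 * t))) ^ 2) :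
    ContDiff ℝ (⊤ : ℕ∞) (fun p : ℝ × ℝ => η p.1 p.2) ∧
    ContDiff ℝ (⊤ : ℕ∞) (fun p : ℝ × ℝ => u p.1 p.2) ∧
    ∀ x t : ℝ,
      (deriv (fun s => η x s) t + deriv (fun y => u y t) x +
        deriv (fun y => η y t * u y t) x -
        (1 / 3 : ℝ) * iteratedDeriv 2 (fun y => deriv (fun s => η y s) t) x = 0) ∧
      (deriv (fun s => u x s) t + deriv (fun y => η y t) x +
        deriv (fun y => (u y t) ^ 2 / 2) x -
        (1 / 3 : ℝ) * iteratedDeriv 3 (fun y => η y t) x -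
        (1 / 3 : ℝ) * iteratedDeriv 2 (fun y => deriv (fun s => u y s) t) x = 0) := by
  obtain rfl : η = fun _ _ => -1 := by
    ext x t
    exact hη x t
  obtain rfl : u = fun x t => 1 + 6 * sechSq (x - 20 - 3 * t) := by
    ext x t
    exact hu x t
  refine ⟨contDiff_const, contDiff_const.add (contDiff_const.mul
    (contDiff_sechSq.comp (by fun_prop))), fun x t => ?_⟩
  have hx (y : ℝ) : HasDerivAt (fun y : ℝ => y - 20 - 3 * t) 1 y :=
    ((hasDerivAt_id y).sub_const 20).sub_const (3 * t)
  have ht (y : ℝ) : HasDerivAt (fun s : ℝ => y - 20 - 3 * s) (-3) t := by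
    simpa using ((hasDerivAt_id t).const_mul 3).const_sub (y - 20)
  have hF (y : ℝ) := (hasDerivAt_sechSq (y - 20 - 3 * t)).comp y (hx y)
  have hG (y : ℝ) := (hasDerivAt_sechSqDeriv (y - 20 - 3 * t)).comp y (hx y)
  have hux : HasDerivAt (fun y => 1 + 6 * sechSq (y - 20 - 3 * t))
      (6 * sechSqDeriv (x - 20 - 3 * t)) x :=
    (((hF x).const_mul 6).const_add 1).congr_deriv (by ring)
  have hut (y : ℝ) : deriv (fun s => 1 + 6 * sechSq (y - 20 - 3 * s)) t =
      -18 * sechSqDeriv (y - 20 - 3 * t) := by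
    have hFt := (hasDerivAt_sechSq (y - 20 - 3 * t)).comp t (ht y)
    have h : HasDerivAt (fun s => 1 + 6 * sechSq (y - 20 - 3 * s))
        (6 * (sechSqDeriv (y - 20 - 3 * t) * -3)) t :=
      (hFt.const_mul 6).const_add 1
    rw [h.deriv]
    ring
  have huxt : deriv (fun y => -18 * sechSqDeriv (y - 20 - 3 * t)) = fun y =>
      -18 * (2 * sechSq (y - 20 - 3 * t) - 3 * sechSq (y - 20 - 3 * t) ^ 2) :=
    funext fun y => (((hG y).const_mul (-18)).congr_deriv (by ring)).deriv
  have huxxt : iteratedDeriv 2 (fun y => -18 * sechSqDeriv (y - 20 - 3 * t)) x =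
      -18 * (2 * sechSqDeriv (x - 20 - 3 * t) -
        6 * sechSq (x - 20 - 3 * t) * sechSqDeriv (x - 20 - 3 * t)) := by
    rw [iteratedDeriv_succ, iteratedDeriv_one, huxt]
    refine HasDerivAt.deriv (((((hF x).const_mul 2).sub
      (((hF x).pow 2).const_mul 3)).const_mul (-18)).congr_deriv ?_)
    simp only [Function.comp_apply]
    ring
  have hsq := ((hux.fun_pow 2).div_const 2).deriv
  have hmul := (hux.const_mul (-1)).deriv
  constructor
  · rw [hux.deriv, hmul]
    simp
  · simp only [hut]
    rw [hsq, huxxt]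
    simp [iteratedDeriv_const]
    ring
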